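/- arXiv:1712.04262 — 2 statements merged into one kernel-verified Lean document; each statement's English description precedes it below -/
import Mathlib

section
/- Let K be a field, n > k ≥ 1 integers, R = K[x₁,…,xₙ], and I_{n,k} the ideal generated by all (k+1)-minors of the (k+1)×n Vandermonde matrix M_{n,k}. Then the Krull dimension of R/I_{n,k} equals k. -/
open MvPolynomial

/-- The `(k+1) × n` Vandermonde matrix of variables: the `(i,j)` entry is `xⱼ^i`
(rows indexed by `0,…,k`, columns by the variables `x₁,…,xₙ`). -/
noncomputable def vandermondeMatrix (K : Type*) [Field K] (n k : ℕ) :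
    Matrix (Fin (k + 1)) (Fin n) (MvPolynomial (Fin n) K) :=
  Matrix.of fun i j => (X j : MvPolynomial (Fin n) K) ^ (i : ℕ)

/-- The ideal generated by all maximal (i.e. `(k+1)`-size) minors of the
Vandermonde matrix `vandermondeMatrix K n k`. -/
noncomputable def vanIdeal (K : Type*) [Field K] (n k : ℕ) :
    Ideal (MvPolynomial (Fin n) K) :=
  Ideal.span { d | ∃ g : Fin (k + 1) ↪ Fin n,
    d = ((vandermondeMatrix K n k).submatrix id g).det }

/-- Under a ring homomorphism, a maximal minor of the Vandermonde matrix of variables becomes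
the Vandermonde determinant of the images of the chosen variables. -/
theorem map_det_vandermondeMatrix_submatrix {K S : Type*} [Field K] [CommRing S] {n k : ℕ}
    (φ : MvPolynomial (Fin n) K →+* S) (g : Fin (k + 1) → Fin n) :
    φ ((vandermondeMatrix K n k).submatrix id g).det =
      (Matrix.vandermonde fun i => φ (X (g i))).det := by
  rw [RingHom.map_det, ← Matrix.det_transpose]
  congr 1
  ext i j
  simp [vandermondeMatrix, Matrix.vandermonde_apply]

/-- A homomorphism to a domain kills the maximal minors only if the variables take at most `k`
distinct values. -/
theorem card_image_X_le_of_vanIdeal_le_ker {K S : Type*} [Field K] [CommRing S] [IsDomain S]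
    [DecidableEq S] {n k : ℕ} (φ : MvPolynomial (Fin n) K →+* S)
    (h : vanIdeal K n k ≤ RingHom.ker φ) :
    (Finset.univ.image fun i => φ (X i)).card ≤ k := by
  by_contra! hlt
  obtain ⟨t, hts, ht⟩ := Finset.exists_subset_card_eq (Nat.succ_le_of_lt hlt)
  let e := t.equivFinOfCardEq ht
  have hpre (i : Fin (k + 1)) : ∃ j : Fin n, φ (X j) = e.symm i := by
    simpa using hts (e.symm i).2
  choose g hg using hpre
  have hinj : Function.Injective fun i => φ (X (g i)) := fun a b hab =>
    e.symm.injective (Subtype.ext (by simpa [hg] using hab))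
  have hg_inj : Function.Injective g := fun a b hab => hinj (by simp [hab])
  refine Matrix.det_vandermonde_ne_zero_iff.mpr hinj ?_
  rw [← map_det_vandermondeMatrix_submatrix]
  exact h (Ideal.subset_span ⟨⟨g, hg_inj⟩, rfl⟩)

/-- A quotient of a polynomial ring over a field in which the variables take at most `k` distinct
values has Krull dimension at most `k`. -/
theorem ringKrullDim_le_card_image_X {K S σ : Type*} [Field K] [CommRing S] [Fintype σ]
    [DecidableEq S] (φ : MvPolynomial σ K →+* S) (hφ : Function.Surjective φ) :
    ringKrullDim S ≤ (Finset.univ.image fun i => φ (X i)).card := by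
  set s := Finset.univ.image fun i => φ (X i)
  let f : σ → s := fun i => ⟨φ (X i), Finset.mem_image_of_mem _ (Finset.mem_univ i)⟩
  let ψ : MvPolynomial s K →+* S := eval₂Hom (φ.comp C) (↑)
  have hcomp : ψ.comp (rename f).toRingHom = φ := by
    ext <;> simp [ψ, f]
  have hψ : Function.Surjective ψ := by
    rw [← hcomp] at hφ
    exact Function.Surjective.of_comp hφ
  refine (ringKrullDim_le_of_surjective ψ hψ).trans ?_
  simp [MvPolynomial.ringKrullDim_of_isNoetherianRing]

/-- The Krull dimension of a quotient is bounded by that of its quotients by prime ideals. -/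
theorem ringKrullDim_quotient_le_of_forall_isPrime {R : Type*} [CommRing R] {I : Ideal R}
    {d : WithBot ℕ∞}
    (h : ∀ P : Ideal R, P.IsPrime → I ≤ P → ringKrullDim (R ⧸ P) ≤ d) :
    ringKrullDim (R ⧸ I) ≤ d := by
  rw [ringKrullDim_quotient]
  refine iSup_le fun l => ?_
  refine le_trans ?_ (h l.head.1.asIdeal l.head.1.isPrime l.head.2)
  rw [ringKrullDim_quotient]
  let l' : LTSeries (PrimeSpectrum.zeroLocus (R := R) l.head.1.asIdeal) :=
    { length := l.length
      toFun := fun i => ⟨(l i).1, l.head_le i⟩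
      step := fun i => l.step i }
  exact le_iSup (fun p : LTSeries _ => (p.length : WithBot ℕ∞)) l'

/-- If the variables are specialised to at most `k` distinct values, then all maximal minors of
the Vandermonde matrix vanish. -/
theorem vanIdeal_le_ker_rename {K σ : Type*} [Field K] [Fintype σ] {n k : ℕ}
    (hσ : Fintype.card σ ≤ k) (f : Fin n → σ) :
    vanIdeal K n k ≤ RingHom.ker (rename f : MvPolynomial (Fin n) K →ₐ[K] _).toRingHom := by
  refine Ideal.span_le.mpr ?_
  rintro _ ⟨g, rfl⟩
  obtain ⟨i, j, hij, hf⟩ := Fintype.exists_ne_map_eq_of_card_lt (fun i => f (g i))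
    (by simpa using Nat.lt_succ_of_le hσ)
  rw [SetLike.mem_coe, RingHom.mem_ker, map_det_vandermondeMatrix_submatrix]
  exact Matrix.det_zero_of_row_eq hij (by ext; simp [Matrix.vandermonde_apply, hf])

/-- Vandermonde determinantal ideals: the Krull dimension of `R ⧸ I_{n,k}` is `k`. -/
theorem vanIdeal_quotient_krullDim (K : Type*) [Field K] (n k : ℕ)
    (hk : 1 ≤ k) (hn : k < n) :
    ringKrullDim (MvPolynomial (Fin n) K ⧸ vanIdeal K n k) = k := by
  classical
  apply le_antisymm
  · refine ringKrullDim_quotient_le_of_forall_isPrime fun P hP hIP => ?_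
    refine (ringKrullDim_le_card_image_X _ (Ideal.Quotient.mk_surjective (I := P))).trans ?_
    exact_mod_cast card_image_X_le_of_vanIdeal_le_ker (Ideal.Quotient.mk P)
      (by rwa [Ideal.mk_ker])
  · let f : Fin n → Fin k := fun i => ⟨min i (k - 1), by omega⟩
    have hf : Function.Surjective f := fun j =>
      ⟨⟨j, by omega⟩, Fin.ext (by simp only [f]; omega)⟩
    let φ := (rename f : MvPolynomial (Fin n) K →ₐ[K] _).toRingHom
    have hker : ∀ a ∈ vanIdeal K n k, φ a = 0 := fun a ha =>
      vanIdeal_le_ker_rename (by simp) f ha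
    have hdim := ringKrullDim_le_of_surjective (Ideal.Quotient.lift _ φ hker)
      (Ideal.Quotient.lift_surjective_of_surjective _ hker (rename_surjective f hf))
    simpa [MvPolynomial.ringKrullDim_of_isNoetherianRing] using hdim
end

section
/- Let K be a field, n > k ≥ 1 integers, R = K[x₁,…,xₙ], and I_{n,k} the ideal generated by all (k+1)-minors of the (k+1)×n Vandermonde matrix M_{n,k}. Then the degree (multiplicity) of the standard graded ring R/√(I_{n,k}), where √(I_{n,k}) is the radical of I_{n,k}, equals S(n,k), the Stirling number of the second kind. -/
open MvPolynomial

/-- The Hilbert function of `R ⧸ I` for `R = K[x₁,…,xₙ]` standard graded: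
`j ↦ dim_K (R ⧸ I)_j`, where `(R ⧸ I)_j` is the image of the space of homogeneous
polynomials of degree `j` in `R ⧸ I`. -/
noncomputable def hilbertFn (K : Type*) [Field K] {n : ℕ}
    (I : Ideal (MvPolynomial (Fin n) K)) (j : ℕ) : ℕ :=
  Module.finrank K ((MvPolynomial.homogeneousSubmodule (Fin n) K j).map
    (Ideal.Quotient.mkₐ K I).toLinearMap)

/-- `hasDegree K I e` says that the standard graded algebra `R ⧸ I` has degree
(multiplicity) `e`: there is a (Hilbert) polynomial `P` agreeing with the Hilbert
function of `R ⧸ I` in all large degrees, and `e = (d-1)! ·` (leading coefficient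
of `P`), where `d` is the Krull dimension of `R ⧸ I`. -/
def hasDegree (K : Type*) [Field K] {n : ℕ}
    (I : Ideal (MvPolynomial (Fin n) K)) (e : ℚ) : Prop :=
  ∃ (P : Polynomial ℚ) (d : ℕ),
    ringKrullDim (MvPolynomial (Fin n) K ⧸ I) = d ∧
    (∀ᶠ j : ℕ in Filter.atTop, (hilbertFn K I j : ℚ) = P.eval (j : ℚ)) ∧
    e = (d - 1).factorial * P.leadingCoeff

/-- The Stirling number of the second kind `S(n,k)`: the number of partitions of an
`n`-element set into `k` nonempty subsets. -/
noncomputable def stirling2 (n k : ℕ) : ℕ :=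
  Nat.card {P : Finpartition (Finset.univ : Finset (Fin n)) // P.parts.card = k}

/-- The exponents of the monomials of `K[x₁,…,xₙ]` outside the lexicographic initial ideal of
`vanIdeal K n k`. -/
def IsStdExponent : (n k : ℕ) → (Fin n → ℕ) → Prop
  | 0, _, _ => True
  | _ + 1, 0, _ => False
  | n + 1, k + 1, m =>
    if m 0 < k + 1 then IsStdExponent n (k + 1) (Fin.tail m) else IsStdExponent n k (Fin.tail m)

/-- The polynomials all of whose monomials are standard. -/
noncomputable def stdSubmodule (K : Type*) [Field K] (n k : ℕ) :
    Submodule K (MvPolynomial (Fin n) K) :=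
  restrictSupport K {m : Fin n →₀ ℕ | IsStdExponent n k m}

/-- The ideal of the polynomials vanishing at all points with at most `k` distinct coordinates. -/
noncomputable def diagIdeal (K : Type*) [Field K] (n k : ℕ) : Ideal (MvPolynomial (Fin n) K) :=
  ⨅ f : Fin n → Fin k,
    RingHom.ker (rename f : MvPolynomial (Fin n) K →ₐ[K] MvPolynomial (Fin k) K)

section

variable {K : Type*} [Field K] {n k : ℕ}

theorem mem_diagIdeal {p : MvPolynomial (Fin n) K} :
    p ∈ diagIdeal K n k ↔ ∀ f : Fin n → Fin k, rename f p = 0 := by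
  simp [diagIdeal, Submodule.mem_iInf, RingHom.mem_ker]

theorem mem_stdSubmodule {p : MvPolynomial (Fin n) K} :
    p ∈ stdSubmodule K n k ↔ ∀ m, coeff m p ≠ 0 → IsStdExponent n k m := by
  simp [stdSubmodule, mem_restrictSupport_iff, Set.subset_def]

theorem minor_eq_prod (g : Fin (k + 1) ↪ Fin n) :
    ((vandermondeMatrix K n k).submatrix id g).det =
      ∏ i, ∏ j ∈ Finset.Ioi i, (X (g j) - X (g i)) := by
  rw [← Matrix.det_vandermonde, ← Matrix.det_transpose]
  rfl

theorem minor_mem_vanIdeal (g : Fin (k + 1) ↪ Fin n) :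
    ∏ i, ∏ j ∈ Finset.Ioi i, (X (g j) - X (g i)) ∈ vanIdeal K n k :=
  Ideal.subset_span ⟨g, (minor_eq_prod g).symm⟩

theorem vanIdeal_le_diagIdeal : vanIdeal K n k ≤ diagIdeal K n k := by
  rw [vanIdeal, Ideal.span_le]
  rintro _ ⟨g, rfl⟩
  rw [SetLike.mem_coe, mem_diagIdeal]
  intro f
  obtain ⟨a, b, hab, h⟩ := Fintype.exists_ne_map_eq_of_card_lt (f ∘ g) (by simp)
  rw [← AlgHom.coe_toRingHom, RingHom.map_det]
  refine Matrix.det_zero_of_column_eq hab fun i => ?_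
  simp only [Function.comp_apply] at h
  simp [vandermondeMatrix, h]

theorem finSuccEquiv_rename_cons_succ {m : ℕ} (f : Fin n → Fin m)
    (p : MvPolynomial (Fin (n + 1)) K) :
    finSuccEquiv K m (rename (Fin.cons 0 (Fin.succ ∘ f) : Fin (n + 1) → Fin (m + 1)) p) =
      (finSuccEquiv K n p).map (rename f).toRingHom := by
  induction p using MvPolynomial.induction_on with
  | C a => simp [finSuccEquiv_apply]
  | add p q hp hq => simp [hp, hq]
  | mul_X p i hp =>
    rw [map_mul, map_mul, hp]
    refine Fin.cases ?_ (fun j => ?_) i <;> simp [finSuccEquiv_X_zero, finSuccEquiv_X_succ]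

theorem rename_cons {m : ℕ} (a : Fin m) (f : Fin n → Fin m)
    (p : MvPolynomial (Fin (n + 1)) K) :
    rename (Fin.cons a f : Fin (n + 1) → Fin m) p =
      ((finSuccEquiv K n p).map (rename f).toRingHom).eval (X a) := by
  induction p using MvPolynomial.induction_on with
  | C a => simp [finSuccEquiv_apply]
  | add p q hp hq => simp [hp, hq]
  | mul_X p i hp =>
    rw [map_mul, hp]
    refine Fin.cases ?_ (fun j => ?_) i <;> simp [finSuccEquiv_X_zero, finSuccEquiv_X_succ]

theorem eq_zero_of_mem_diagIdeal_of_mem_stdSubmodule {p : MvPolynomial (Fin n) K}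
    (hp : p ∈ diagIdeal K n k) (hs : p ∈ stdSubmodule K n k) : p = 0 := by
  induction n generalizing k with
  | zero =>
    rw [mem_diagIdeal] at hp
    exact rename_injective (Fin.elim0 : Fin 0 → Fin k) (Function.injective_of_subsingleton _)
      (by rw [hp, map_zero])
  | succ n ih =>
    rw [mem_stdSubmodule] at hs
    cases k with
    | zero =>
      ext m
      by_contra h
      exact hs m h
    | succ k =>
      rw [mem_diagIdeal] at hp
      have key (d : ℕ) (m : Fin n →₀ ℕ) (h : coeff m ((finSuccEquiv K n p).coeff d) ≠ 0) :
          if d < k + 1 then IsStdExponent n (k + 1) m else IsStdExponent n k m := by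
        rw [finSuccEquiv_coeff_coeff] at h
        exact hs _ h
      have hlarge (d : ℕ) (hd : ¬ d < k + 1) : (finSuccEquiv K n p).coeff d = 0 := by
        refine ih (k := k) (mem_diagIdeal.2 fun f => ?_) (mem_stdSubmodule.2 fun m hm => ?_)
        · have := congrArg (finSuccEquiv K k) (hp (Fin.cons 0 (Fin.succ ∘ f)))
          rw [finSuccEquiv_rename_cons_succ, map_zero] at this
          simpa using congrArg (Polynomial.coeff · d) this
        · simpa [hd] using key d m hm
      have hsmall (d : ℕ) (hd : d < k + 1) : (finSuccEquiv K n p).coeff d = 0 := by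
        refine ih (k := k + 1) (mem_diagIdeal.2 fun f => ?_) (mem_stdSubmodule.2 fun m hm => ?_)
        · have h0 : (finSuccEquiv K n p).map (rename f).toRingHom = 0 := by
            refine Polynomial.eq_zero_of_natDegree_lt_card_of_eval_eq_zero _
              (X_injective (R := K) (σ := Fin (k + 1))) (fun a => ?_) ?_
            · rw [← rename_cons, hp]
            · refine lt_of_le_of_lt (b := k) ?_ (by simp)
              rw [Polynomial.natDegree_le_iff_coeff_eq_zero]
              intro d hd
              rw [Polynomial.coeff_map, hlarge d (by omega), map_zero]
          simpa using congrArg (Polynomial.coeff · d) h0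
        · simpa [hd] using key d m hm
      refine (finSuccEquiv K n).injective ?_
      rw [map_zero]
      ext1 d
      by_cases hd : d < k + 1
      · simpa using hsmall d hd
      · simpa using hlarge d hd

theorem rename_succ_mem_vanIdeal {p : MvPolynomial (Fin n) K} (hp : p ∈ vanIdeal K n k) :
    rename Fin.succ p ∈ vanIdeal K (n + 1) k := by
  suffices h : vanIdeal K n k ≤ (vanIdeal K (n + 1) k).comap (rename Fin.succ) from h hp
  rw [vanIdeal, Ideal.span_le]
  rintro _ ⟨g, rfl⟩
  rw [minor_eq_prod]
  simpa [Ideal.mem_comap] using minor_mem_vanIdeal (K := K) (g.trans (Fin.succEmb n))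

theorem finSuccEquiv_symm_C (p : MvPolynomial (Fin n) K) :
    (finSuccEquiv K n).symm (Polynomial.C p) = rename Fin.succ p := by
  rw [AlgEquiv.symm_apply_eq]
  induction p using MvPolynomial.induction_on with
  | C a => simp [finSuccEquiv_apply]
  | add p q hp hq => simp [hp, hq]
  | mul_X p i hp => simp [hp, finSuccEquiv_X_succ]

theorem finSuccEquiv_symm_X :
    (finSuccEquiv K n).symm Polynomial.X = X 0 := by
  rw [AlgEquiv.symm_apply_eq, finSuccEquiv_X_zero]

theorem degree_C_mul_lt {R : Type*} [Semiring R] {r : Polynomial R} {d : ℕ} (a : R)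
    (hr : r.degree < d) : (Polynomial.C a * r).degree < d := by
  rw [Polynomial.degree_lt_iff_coeff_zero] at hr ⊢
  intro m hm
  rw [Polynomial.coeff_C_mul, hr m hm, mul_zero]

theorem exists_sub_mem_vanIdeal_of_mem {p : MvPolynomial (Fin n) K} (hp : p ∈ vanIdeal K n k)
    {d : ℕ} (hd : k + 1 ≤ d) :
    ∃ r : Polynomial (MvPolynomial (Fin n) K), r.degree < d ∧
      (finSuccEquiv K n).symm (Polynomial.C p * Polynomial.X ^ d - r) ∈
        vanIdeal K (n + 1) (k + 1) := by
  induction hp using Submodule.span_induction with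
  | zero => exact ⟨0, by simp, by simp⟩
  | add p q _ _ hp hq =>
    obtain ⟨r, hr, hr'⟩ := hp
    obtain ⟨s, hs, hs'⟩ := hq
    refine ⟨r + s, (Polynomial.degree_add_le _ _).trans_lt (max_lt hr hs), ?_⟩
    convert! Ideal.add_mem _ hr' hs' using 1
    rw [← map_add]
    congr 1
    simp
    ring
  | smul a p _ hp =>
    obtain ⟨r, hr, hr'⟩ := hp
    refine ⟨Polynomial.C a * r, ?_, ?_⟩
    · exact degree_C_mul_lt a hr
    · convert! Ideal.mul_mem_left _ ((finSuccEquiv K n).symm (Polynomial.C a)) hr' using 1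
      rw [← map_mul]
      congr 1
      simp
      ring
  | mem p hp =>
    obtain ⟨g, rfl⟩ := hp
    rw [minor_eq_prod]
    set c : MvPolynomial (Fin n) K := ∏ i, ∏ j ∈ Finset.Ioi i, (X (g j) - X (g i)) with hc
    set M : Polynomial (MvPolynomial (Fin n) K) :=
      (∏ i, (Polynomial.X - Polynomial.C (X (g i)))) * Polynomial.X ^ (d - (k + 1)) with hM
    have hmonic : M.Monic :=
      (Polynomial.monic_prod_of_monic _ _ fun i _ => Polynomial.monic_X_sub_C _).mul
        (Polynomial.monic_X_pow _)
    have hdeg : M.degree = d := by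
      rw [hM, Polynomial.degree_mul, Polynomial.degree_prod]
      simp only [Polynomial.degree_X_sub_C, Polynomial.degree_X_pow, Finset.sum_const,
        Finset.card_univ, Fintype.card_fin, nsmul_eq_mul, mul_one]
      norm_cast
      omega
    refine ⟨Polynomial.C c * (Polynomial.X ^ d - M), ?_, ?_⟩
    · refine degree_C_mul_lt c ?_
      have := Polynomial.degree_sub_lt_left (p := Polynomial.X ^ d) (q := M)
        (by rw [hdeg, Polynomial.degree_X_pow]) (by simp)
        (by rw [hmonic.leadingCoeff, Polynomial.leadingCoeff_X_pow])
      rwa [Polynomial.degree_X_pow] at this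
    · have hinj : Function.Injective (Fin.cons 0 (Fin.succ ∘ g) : Fin (k + 2) → Fin (n + 1)) := by
        rw [Fin.cons_injective_iff]
        exact ⟨by simp, (Fin.succ_injective n).comp g.injective⟩
      have hmem := minor_mem_vanIdeal (K := K)
        (⟨Fin.cons 0 (Fin.succ ∘ g), hinj⟩ : Fin (k + 2) ↪ Fin (n + 1))
      rw [Fin.prod_univ_succ, Fin.Ioi_zero_eq_map] at hmem
      simp only [Fin.prod_Ioi_succ] at hmem
      simp only [Finset.prod_map, Fin.coe_succEmb, Function.Embedding.coeFn_mk,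
        Fin.cons_zero, Fin.cons_succ, Function.comp_apply] at hmem
      have hneg : ∏ i, ((X (g i).succ : MvPolynomial (Fin (n + 1)) K) - X 0) =
          (-1) ^ (k + 1) * ∏ i, (X 0 - X (g i).succ) := by
        simp_rw [← neg_sub (X 0 : MvPolynomial (Fin (n + 1)) K), Finset.prod_neg]
        simp
      rw [hneg] at hmem
      have := Ideal.mul_mem_left _ ((-1) ^ (k + 1) * X 0 ^ (d - (k + 1))) hmem
      convert! this using 1
      have : Polynomial.C c * Polynomial.X ^ d - Polynomial.C c * (Polynomial.X ^ d - M) =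
        Polynomial.C c * M := by ring
      rw [this, hM]
      simp only [map_mul, map_prod, map_sub, map_pow, finSuccEquiv_symm_C, finSuccEquiv_symm_X,
        hc, rename_X]
      have h1 : ((-1 : MvPolynomial (Fin (n + 1)) K) ^ (k + 1)) * (-1) ^ (k + 1) = 1 := by
        rw [← mul_pow]; simp
      linear_combination -(X 0 ^ (d - (k + 1)) * (∏ i, (X 0 - X (g i).succ)) *
        ∏ i, ∏ j ∈ Finset.Ioi i, (X (g j).succ - X (g i).succ)) * h1

theorem rename_succ_mul_X_pow_mem_stdSubmodule {l d : ℕ} {s : MvPolynomial (Fin n) K}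
    (hs : s ∈ stdSubmodule K n l) (hl : l = if d < k + 1 then k + 1 else k) :
    (finSuccEquiv K n).symm (Polynomial.C s * Polynomial.X ^ d) ∈
      stdSubmodule K (n + 1) (k + 1) := by
  rw [mem_stdSubmodule] at hs ⊢
  intro m hm
  rw [← Finsupp.cons_tail m, ← finSuccEquiv_coeff_coeff, AlgEquiv.apply_symm_apply,
    Polynomial.coeff_C_mul_X_pow] at hm
  split_ifs at hm with h
  · have : IsStdExponent n l (Fin.tail m) := hs _ hm
    rw [IsStdExponent, h]
    subst hl
    split_ifs with hd <;> simpa [hd] using this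
  · simp at hm

theorem vanIdeal_sup_stdSubmodule (p : MvPolynomial (Fin n) K) :
    p ∈ (vanIdeal K n k).restrictScalars K ⊔ stdSubmodule K n k := by
  induction n generalizing k with
  | zero => exact Submodule.mem_sup_right (mem_stdSubmodule.2 fun m _ => trivial)
  | succ n ih =>
    cases k with
    | zero =>
      have h : vanIdeal K (n + 1) 0 = ⊤ := by
        rw [Ideal.eq_top_iff_one]
        simpa using minor_mem_vanIdeal (K := K) (k := 0) (Fin.castLEEmb (Nat.le_add_left 1 n))
      exact Submodule.mem_sup_left (by simp [h])
    | succ k =>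
      suffices h : ∀ (d : ℕ) (q : Polynomial (MvPolynomial (Fin n) K)), q.degree < d →
          (finSuccEquiv K n).symm q ∈ (vanIdeal K (n + 1) (k + 1)).restrictScalars K ⊔
            stdSubmodule K (n + 1) (k + 1) by
        have := h _ _ (Polynomial.degree_le_natDegree.trans_lt
          (WithBot.coe_lt_coe.2 (Nat.lt_succ_self (finSuccEquiv K n p).natDegree)))
        rwa [AlgEquiv.symm_apply_apply] at this
      intro d
      induction d with
      | zero =>
        intro q hq
        rw [Polynomial.degree_eq_bot.1 (Nat.WithBot.lt_zero_iff.1 hq), map_zero]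
        exact Submodule.zero_mem _
      | succ d ihd =>
        intro q hq
        have herase : (q.erase d).degree < d := by
          rw [Polynomial.degree_lt_iff_coeff_zero] at hq ⊢
          intro m hm
          rw [Polynomial.coeff_erase]
          split_ifs with h
          · rfl
          · exact hq m (by omega)
        rw [← Polynomial.monomial_add_erase q d, map_add, ← Polynomial.C_mul_X_pow_eq_monomial]
        refine Submodule.add_mem _ ?_ (ihd _ herase)
        obtain ⟨i, hi, s, hs, his⟩ :=
          Submodule.mem_sup.1 (ih (k := if d < k + 1 then k + 1 else k) (q.coeff d))
        rw [← his, Polynomial.C_add, add_mul, map_add]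
        refine Submodule.add_mem _ ?_
          (Submodule.mem_sup_right (rename_succ_mul_X_pow_mem_stdSubmodule hs rfl))
        by_cases hd : d < k + 1
        · rw [if_pos hd] at hi
          refine Submodule.mem_sup_left ?_
          rw [map_mul, finSuccEquiv_symm_C]
          exact Ideal.mul_mem_right _ _ (rename_succ_mem_vanIdeal hi)
        · rw [if_neg hd] at hi
          obtain ⟨r, hr, hr'⟩ := exists_sub_mem_vanIdeal_of_mem hi (d := d) (by omega)
          rw [← sub_add_cancel (Polynomial.C i * Polynomial.X ^ d) r, map_add]
          exact Submodule.add_mem _ (Submodule.mem_sup_left hr') (ihd _ hr)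

theorem vanIdeal_eq_diagIdeal : vanIdeal K n k = diagIdeal K n k := by
  refine le_antisymm vanIdeal_le_diagIdeal fun p hp => ?_
  obtain ⟨i, hi, s, hs, rfl⟩ := Submodule.mem_sup.1 (vanIdeal_sup_stdSubmodule (k := k) p)
  have : s ∈ diagIdeal K n k := by
    simpa using Ideal.sub_mem _ hp (vanIdeal_le_diagIdeal (show i ∈ vanIdeal K n k from hi))
  rw [eq_zero_of_mem_diagIdeal_of_mem_stdSubmodule this hs, add_zero]
  exact hi

theorem radical_vanIdeal : (vanIdeal K n k).radical = diagIdeal K n k := by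
  rw [vanIdeal_eq_diagIdeal]
  refine Ideal.IsRadical.radical fun p hp => mem_diagIdeal.2 fun f => ?_
  obtain ⟨m, hm⟩ := hp
  have := mem_diagIdeal.1 hm f
  rw [map_pow] at this
  exact eq_zero_of_pow_eq_zero this

theorem homogeneousComponent_mem_diagIdeal {p : MvPolynomial (Fin n) K} (hp : p ∈ diagIdeal K n k)
    (j : ℕ) : homogeneousComponent j p ∈ diagIdeal K n k := by
  rw [mem_diagIdeal] at hp ⊢
  intro f
  rw [rename_homogeneousComponent, hp, map_zero]

open Classical in
/-- The exponents of degree `j` of standard monomials. -/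
noncomputable def stdExponents (n k j : ℕ) : Finset (Fin n → ℕ) :=
  (Finset.Nat.antidiagonalTuple n j).filter (IsStdExponent n k)

theorem mem_stdExponents {j : ℕ} {m : Fin n → ℕ} :
    m ∈ stdExponents n k j ↔ ∑ i, m i = j ∧ IsStdExponent n k m := by
  simp [stdExponents, Finset.Nat.mem_antidiagonalTuple]

theorem hilbertFn_diagIdeal (j : ℕ) :
    hilbertFn K (diagIdeal K n k) j = (stdExponents n k j).card := by
  set s : Set (Fin n →₀ ℕ) := {m | ⇑m ∈ stdExponents n k j} with hs
  set φ := (Ideal.Quotient.mkₐ K (diagIdeal K n k)).toLinearMap with hφ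
  have hφ0 (p : MvPolynomial (Fin n) K) : φ p = 0 ↔ p ∈ diagIdeal K n k :=
    Ideal.Quotient.eq_zero_iff_mem
  have hstd : restrictSupport K s ≤ stdSubmodule K n k :=
    restrictSupport_mono _ fun m hm => (mem_stdExponents.1 hm).2
  have hmap : (homogeneousSubmodule (Fin n) K j).map φ = (restrictSupport K s).map φ := by
    apply le_antisymm
    · rintro _ ⟨p, hp, rfl⟩
      obtain ⟨i, hi, t, ht, rfl⟩ := Submodule.mem_sup.1 (vanIdeal_sup_stdSubmodule (k := k) p)
      refine ⟨homogeneousComponent j t, ?_, ?_⟩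
      · rw [SetLike.mem_coe, mem_restrictSupport_iff]
        intro m hm
        rw [Finset.mem_coe, mem_support_iff, coeff_homogeneousComponent] at hm
        split_ifs at hm with h
        · refine mem_stdExponents.2 ⟨?_, mem_stdSubmodule.1 ht m hm⟩
          rw [← h, Finsupp.degree_eq_sum]
        · exact absurd rfl hm
      · rw [← sub_eq_zero, ← map_sub, hφ0, ← neg_mem_iff, neg_sub,
          ← homogeneousComponent_eq_self hp, map_add, add_sub_cancel_right]
        exact homogeneousComponent_mem_diagIdeal (vanIdeal_le_diagIdeal hi) j
    · refine Submodule.map_mono fun p hp => ?_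
      rw [mem_homogeneousSubmodule]
      intro m hm
      have := (mem_stdExponents.1 (hp (mem_support_iff.2 hm))).1
      rw [← this, ← Finsupp.degree_eq_sum, Finsupp.degree_eq_weight_one]
      rfl
  have hinj : Function.Injective (φ.domRestrict (restrictSupport K s)) := by
    rw [injective_iff_map_eq_zero]
    rintro ⟨p, hp⟩ h
    exact Subtype.ext
      (eq_zero_of_mem_diagIdeal_of_mem_stdSubmodule ((hφ0 p).1 h) (hstd hp))
  rw [hilbertFn, hmap, ← LinearMap.range_domRestrict, LinearMap.finrank_range_of_inj hinj,
    Module.finrank_eq_nat_card_basis (basisRestrictSupport K s), ← Fintype.card_coe,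
    ← Nat.card_eq_fintype_card]
  exact Nat.card_congr (Finsupp.equivFunOnFinite.subtypeEquiv fun m => Iff.rfl)

theorem ringKrullDim_quotient_ker_rename_le [NeZero n] (f : Fin n → Fin k) :
    ringKrullDim (MvPolynomial (Fin n) K ⧸
      RingHom.ker (rename f : MvPolynomial (Fin n) K →ₐ[K] MvPolynomial (Fin k) K)) ≤ k := by
  have hdim : ringKrullDim (MvPolynomial (Fin k) K) = k := by
    simp [MvPolynomial.ringKrullDim_of_isNoetherianRing]
  rw [← hdim]
  refine ringKrullDim_le_of_surjective
    ((Ideal.Quotient.mk _).comp (rename (Function.invFun f)).toRingHom) fun q => ?_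
  obtain ⟨p, rfl⟩ := Ideal.Quotient.mk_surjective q
  refine ⟨rename f p, Ideal.Quotient.eq.2 ?_⟩
  have : f ∘ Function.invFun f ∘ f = f := funext fun i => Function.invFun_eq ⟨i, rfl⟩
  simp [RingHom.mem_ker, rename_rename, this]

theorem ringKrullDim_quotient_diagIdeal (hk : 1 ≤ k) (hn : k ≤ n) :
    ringKrullDim (MvPolynomial (Fin n) K ⧸ diagIdeal K n k) = k := by
  have : NeZero k := ⟨by omega⟩
  have : NeZero n := ⟨by omega⟩
  apply le_antisymm
  · rw [ringKrullDim_quotient, Order.krullDim, iSup_le_iff]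
    intro l
    obtain ⟨f, hf⟩ : ∃ f : Fin n → Fin k,
        RingHom.ker (rename f : MvPolynomial (Fin n) K →ₐ[K] MvPolynomial (Fin k) K) ≤
          (l.head : PrimeSpectrum _).asIdeal := by
      have hl : diagIdeal K n k ≤ (l.head : PrimeSpectrum _).asIdeal := l.head.2
      have hinf : diagIdeal K n k = Finset.univ.inf fun f : Fin n → Fin k =>
          RingHom.ker (rename f : MvPolynomial (Fin n) K →ₐ[K] MvPolynomial (Fin k) K) := by
        rw [Finset.inf_univ_eq_iInf]
        rfl
      obtain ⟨f, -, hf⟩ := l.head.1.2.inf_le'.1 (hinf.ge.trans hl)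
      exact ⟨f, hf⟩
    refine le_trans ?_ (ringKrullDim_quotient_ker_rename_le (K := K) f)
    rw [ringKrullDim_quotient]
    let s : LTSeries (PrimeSpectrum.zeroLocus (RingHom.ker
        (rename f : MvPolynomial (Fin n) K →ₐ[K] MvPolynomial (Fin k) K) : Set _)) :=
      LTSeries.mk l.length (fun i => ⟨(l i).1, fun p hp => LTSeries.head_le l i (hf hp)⟩)
        fun i j hij => l.strictMono hij
    exact Order.LTSeries.length_le_krullDim s
  · have hdim : ringKrullDim (MvPolynomial (Fin k) K) = k := by
      simp [MvPolynomial.ringKrullDim_of_isNoetherianRing]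
    have hle (p : MvPolynomial (Fin n) K) (hp : p ∈ diagIdeal K n k) :
        (rename (fun i : Fin n => Fin.ofNat k i)).toRingHom p = 0 := mem_diagIdeal.1 hp _
    have hsurj := Ideal.Quotient.lift_surjective_of_surjective (diagIdeal K n k) hle
      (rename_surjective _ fun i => ⟨Fin.castLE hn i, by simp⟩)
    exact hdim ▸ ringKrullDim_le_of_surjective _ hsurj

end

/-- The numerator of the Hilbert series of `K[x₁,…,xₙ] ⧸ diagIdeal K n k` over `(1 - X) ^ k`. -/
noncomputable def hilbertNumerator : (n k : ℕ) → Polynomial ℚ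
  | 0, k => (1 - Polynomial.X) ^ k
  | _ + 1, 0 => 0
  | n + 1, k + 1 =>
    (∑ i ∈ Finset.range (k + 1), Polynomial.X ^ i) * hilbertNumerator n (k + 1) +
      Polynomial.X ^ (k + 1) * hilbertNumerator n k

theorem eval_one_hilbertNumerator (n k : ℕ) :
    (hilbertNumerator n k).eval 1 = Nat.stirlingSecond n k := by
  induction n generalizing k with
  | zero => cases k <;> simp [hilbertNumerator]
  | succ n ih =>
    cases k with
    | zero => simp [hilbertNumerator]
    | succ k => simp [hilbertNumerator, Nat.stirlingSecond_succ_succ, ih, Polynomial.eval_finsetSum]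

theorem card_stdExponents_succ (n k j : ℕ) :
    (stdExponents (n + 1) (k + 1) j).card =
      ∑ x ∈ Finset.HasAntidiagonal.antidiagonal j,
        if x.1 < k + 1 then (stdExponents n (k + 1) x.2).card else (stdExponents n k x.2).card := by
  classical
  have hmaps : ∀ m ∈ stdExponents (n + 1) (k + 1) j,
      (m 0, ∑ i, Fin.tail m i) ∈ Finset.HasAntidiagonal.antidiagonal j := fun m hm => by
    rw [Finset.HasAntidiagonal.mem_antidiagonal, ← (mem_stdExponents.1 hm).1, Fin.sum_univ_succ]
    rfl
  rw [Finset.card_eq_sum_card_fiberwise hmaps]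
  refine Finset.sum_congr rfl fun x hx => ?_
  rw [Finset.HasAntidiagonal.mem_antidiagonal] at hx
  rw [← apply_ite Finset.card]
  refine Finset.card_nbij' Fin.tail (fun m => (Fin.cons x.1 m : Fin (n + 1) → ℕ)) ?_ ?_ ?_ ?_
  · intro m hm
    simp only [Finset.coe_filter, Set.mem_ofPred_eq, mem_stdExponents, IsStdExponent] at hm
    obtain ⟨⟨-, h⟩, rfl⟩ := hm
    split_ifs at h ⊢ with hlt <;> simpa [mem_stdExponents] using h
  · intro m hm
    simp only [Finset.coe_filter, Set.mem_ofPred_eq, mem_stdExponents, IsStdExponent]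
    split_ifs at hm with hlt <;>
    · rw [Finset.mem_coe, mem_stdExponents] at hm
      simp [Fin.sum_univ_succ, hm, hx, hlt]
  · intro m hm
    simp only [Finset.coe_filter, Set.mem_ofPred_eq] at hm
    rw [← hm.2]
    exact Fin.cons_self_tail m
  · intro m hm
    exact Fin.tail_cons _ _

open PowerSeries in
theorem mk_card_stdExponents (n k : ℕ) :
    (PowerSeries.mk fun j => ((stdExponents n k j).card : ℚ)) =
      (hilbertNumerator n k : ℚ⟦X⟧) * (invOneSubPow ℚ k : ℚ⟦X⟧) := by
  induction n generalizing k with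
  | zero =>
    have h1 : (hilbertNumerator 0 k : ℚ⟦X⟧) = (1 - PowerSeries.X) ^ k := by simp [hilbertNumerator]
    rw [h1, ← invOneSubPow_inv_eq_one_sub_pow, (invOneSubPow ℚ k).inv_val]
    ext j
    classical
    have : stdExponents 0 k j = Finset.Nat.antidiagonalTuple 0 j :=
      Finset.filter_true_of_mem fun _ _ => trivial
    cases j <;> simp [this, PowerSeries.coeff_one]
  | succ n ih =>
    cases k with
    | zero =>
      ext j
      have : stdExponents (n + 1) 0 j = ∅ :=
        Finset.eq_empty_of_forall_notMem fun m hm => (mem_stdExponents.1 hm).2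
      simp [this, hilbertNumerator]
    | succ k =>
      have hrec : (PowerSeries.mk fun j => ((stdExponents (n + 1) (k + 1) j).card : ℚ)) =
          (∑ i ∈ Finset.range (k + 1), PowerSeries.X ^ i) *
              (PowerSeries.mk fun j => ((stdExponents n (k + 1) j).card : ℚ)) +
            PowerSeries.X ^ (k + 1) * PowerSeries.mk 1 *
              (PowerSeries.mk fun j => ((stdExponents n k j).card : ℚ)) := by
        ext j
        rw [map_add, PowerSeries.coeff_mul, PowerSeries.coeff_mul, ← Finset.sum_add_distrib,
          PowerSeries.coeff_mk, card_stdExponents_succ, Nat.cast_sum]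
        refine Finset.sum_congr rfl fun x _ => ?_
        rw [map_sum, PowerSeries.coeff_X_pow_mul']
        by_cases hx : x.1 < k + 1
        · simp [PowerSeries.coeff_X_pow, hx, Nat.lt_succ_iff.1 hx]
        · simp [PowerSeries.coeff_X_pow, hx, not_lt.1 hx]
      have hone : PowerSeries.mk 1 = (invOneSubPow ℚ 1 : ℚ⟦X⟧) := by
        rw [invOneSubPow_val_succ_eq_mk_add_choose]
        ext
        simp
      have hsum : ((∑ i ∈ Finset.range (k + 1), Polynomial.X ^ i : Polynomial ℚ) : ℚ⟦X⟧) =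
          ∑ i ∈ Finset.range (k + 1), PowerSeries.X ^ i := by
        rw [← Polynomial.coeToPowerSeries.ringHom_apply, map_sum]
        simp
      rw [hrec, ih, ih, hone, invOneSubPow_add, Units.val_mul]
      rw [hilbertNumerator, Polynomial.coe_add, Polynomial.coe_mul, Polynomial.coe_mul, hsum,
        Polynomial.coe_pow, Polynomial.coe_X]
      ring

theorem leadingCoeff_hilbertPoly_succ {F : Type*} [Field F] [CharZero F] (p : Polynomial F)
    (d : ℕ) (hp : p.eval 1 ≠ 0) :
    (Polynomial.hilbertPoly p (d + 1)).leadingCoeff = p.eval 1 / d.factorial := by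
  have hcoeff : (Polynomial.hilbertPoly p (d + 1)).coeff d = p.eval 1 / d.factorial := by
    rw [Polynomial.hilbertPoly_succ, Polynomial.finsetSum_coeff, Polynomial.eval_eq_sum,
      Polynomial.sum, Finset.sum_div]
    refine Finset.sum_congr rfl fun i _ => ?_
    rw [Polynomial.coeff_smul, Polynomial.coeff_preHilbertPoly_self]
    simp [div_eq_mul_inv]
  have hdeg : (Polynomial.hilbertPoly p (d + 1)).natDegree = d := by
    refine Polynomial.natDegree_eq_of_le_of_coeff_ne_zero ?_ ?_
    · rw [Polynomial.hilbertPoly_succ]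
      refine Polynomial.natDegree_sum_le_of_forall_le _ _ fun i _ => ?_
      exact (Polynomial.natDegree_smul_le _ _).trans (Polynomial.natDegree_preHilbertPoly ..).le
    · rw [hcoeff]
      exact div_ne_zero hp (Nat.cast_ne_zero.2 d.factorial_ne_zero)
  rw [Polynomial.leadingCoeff, hdeg, hcoeff]

/-- A partition of `Fin n` with `k` labelled parts is a surjection `Fin n → Fin k`. -/
theorem card_surjective_eq_stirling2_mul (n k : ℕ) :
    Nat.card {f : Fin n → Fin k // Function.Surjective f} = stirling2 n k * k.factorial := by
  classical
  let F : (Σ P : {P : Finpartition (Finset.univ : Finset (Fin n)) // P.parts.card = k},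
      (P.1.parts ≃ Fin k)) → {f : Fin n → Fin k // Function.Surjective f} := fun Q =>
    ⟨fun x => Q.2 ⟨Q.1.1.part x, Q.1.1.part_mem.2 (Finset.mem_univ x)⟩, fun i => by
      obtain ⟨x, hx⟩ := Q.1.1.nonempty_of_mem_parts (Q.2.symm i).2
      refine ⟨x, ?_⟩
      rw [← Equiv.eq_symm_apply]
      exact Subtype.ext (Q.1.1.part_eq_of_mem (Q.2.symm i).2 hx)⟩
  have hfiber (Q : Σ P : {P : Finpartition (Finset.univ : Finset (Fin n)) // P.parts.card = k},
      (P.1.parts ≃ Fin k)) (p : Q.1.1.parts) (x : Fin n) : x ∈ p.1 ↔ (F Q).1 x = Q.2 p := by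
    simp only [F, EmbeddingLike.apply_eq_iff_eq]
    refine ⟨fun hx => Subtype.ext (Q.1.1.part_eq_of_mem p.2 hx), fun h => ?_⟩
    rw [← h]
    exact Q.1.1.mem_part (Finset.mem_univ x)
  have hF : Function.Bijective F := by
    constructor
    · rintro Q Q' h
      have hsub : ∀ Q Q', F Q = F Q' → ∀ p : Q.1.1.parts, p.1 = (Q'.2.symm (Q.2 p)).1 := by
        intro Q Q' h p
        ext x
        rw [hfiber, hfiber, h, Equiv.apply_symm_apply]
      have hP : Q.1 = Q'.1 := by
        refine Subtype.ext (Finpartition.ext (Finset.Subset.antisymm ?_ ?_))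
        · intro p hp
          have hpe : p = _ := hsub Q Q' h ⟨p, hp⟩
          rw [hpe]
          exact (Q'.2.symm _).2
        · intro p hp
          have hpe : p = _ := hsub Q' Q h.symm ⟨p, hp⟩
          rw [hpe]
          exact (Q.2.symm _).2
      obtain ⟨P, e⟩ := Q
      obtain ⟨P', e'⟩ := Q'
      obtain rfl : P = P' := hP
      congr 1
      ext1 p
      rw [← Equiv.symm_apply_eq]
      exact Subtype.ext (hsub _ _ h p).symm
    · rintro ⟨f, hf⟩
      let g : Fin k → Finset (Fin n) := fun i => {x | f x = i}
      have hg : Function.Injective g := fun i j hij => by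
        obtain ⟨x, rfl⟩ := hf i
        have : x ∈ g (f x) := by simp [g]
        rw [hij] at this
        simpa [g] using this
      let P : Finpartition (Finset.univ : Finset (Fin n)) :=
        Finpartition.ofExistsUnique (Finset.univ.image g) (fun _ _ => Finset.subset_univ _)
          (fun x _ => ⟨g (f x), by simp [g], by
            rintro _ ⟨hy, hx⟩
            obtain ⟨i, -, rfl⟩ := Finset.mem_image.1 hy
            simp only [g, Finset.mem_filter, Finset.mem_univ, true_and] at hx
            rw [hx]⟩)
          (fun h => by
            obtain ⟨i, -, hi⟩ := Finset.mem_image.1 h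
            obtain ⟨x, rfl⟩ := hf i
            exact Finset.notMem_empty x (hi ▸ by simp [g]))
      have hP : P.parts = Finset.univ.image g := rfl
      have hmem (i : Fin k) : g i ∈ P.parts := Finset.mem_image_of_mem g (Finset.mem_univ i)
      let e : Fin k ≃ P.parts := Equiv.ofBijective (fun i => ⟨g i, hmem i⟩)
        ⟨fun i j hij => hg (congrArg Subtype.val hij), fun ⟨p, hp⟩ => by
          obtain ⟨i, -, rfl⟩ := Finset.mem_image.1 hp
          exact ⟨i, rfl⟩⟩
      have hcard : P.parts.card = k := by
        rw [hP, Finset.card_image_of_injective _ hg, Finset.card_univ, Fintype.card_fin]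
      refine ⟨⟨⟨P, hcard⟩, e.symm⟩, Subtype.ext (funext fun x => ?_)⟩
      have hx : x ∈ (e (f x)).1 := by
        change x ∈ g (f x)
        simp [g]
      exact ((hfiber ⟨⟨P, hcard⟩, e.symm⟩ (e (f x)) x).1 hx).trans (e.symm_apply_apply _)
  rw [← Nat.card_eq_of_bijective F hF, Nat.card_sigma, stirling2, Nat.card_eq_fintype_card]
  rw [Finset.sum_congr rfl fun (P : {P : Finpartition (Finset.univ : Finset (Fin n)) //
    P.parts.card = k}) _ => (?_ : Nat.card (P.1.parts ≃ Fin k) = k.factorial)]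
  · simp
  · have hc : Fintype.card P.1.parts = k := by rw [Fintype.card_coe, P.2]
    rw [Nat.card_eq_fintype_card, Fintype.card_equiv (Fintype.equivFinOfCardEq hc), hc]

theorem card_surjective_succ (n k : ℕ) :
    Nat.card {f : Fin (n + 1) → Fin (k + 1) // Function.Surjective f} =
      (k + 1) * (Nat.card {f : Fin n → Fin (k + 1) // Function.Surjective f} +
        Nat.card {f : Fin n → Fin k // Function.Surjective f}) := by
  let F : Fin (k + 1) × ({f : Fin n → Fin (k + 1) // Function.Surjective f} ⊕
      {f : Fin n → Fin k // Function.Surjective f}) →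
      {f : Fin (n + 1) → Fin (k + 1) // Function.Surjective f} := fun q =>
    ⟨Fin.cons q.1 (Sum.elim (fun g => g.1) (fun g => q.1.succAbove ∘ g.1) q.2), by
      obtain ⟨i, g | g⟩ := q
      · intro j
        obtain ⟨x, hx⟩ := g.2 j
        exact ⟨x.succ, by simpa using hx⟩
      · intro j
        rcases Fin.eq_self_or_eq_succAbove i j with rfl | ⟨l, rfl⟩
        · exact ⟨0, rfl⟩
        · obtain ⟨x, rfl⟩ := g.2 l
          exact ⟨x.succ, by simp⟩⟩
  have hF : Function.Bijective F := by
    constructor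
    · rintro ⟨i, g | g⟩ ⟨j, h | h⟩ heq
      all_goals
        simp only [F, Subtype.mk.injEq, Fin.cons_inj, Sum.elim_inl, Sum.elim_inr] at heq
        obtain ⟨rfl, heq⟩ := heq
      · rw [Subtype.ext heq]
      · obtain ⟨x, hx⟩ := g.2 i
        rw [heq] at hx
        exact absurd hx (Fin.succAbove_ne _ _)
      · obtain ⟨x, hx⟩ := h.2 i
        rw [← heq] at hx
        exact absurd hx (Fin.succAbove_ne _ _)
      · rw [Subtype.ext (Fin.succAbove_right_injective.comp_left heq)]
    · rintro ⟨f, hf⟩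
      by_cases h : Function.Surjective (Fin.tail f)
      · exact ⟨⟨f 0, .inl ⟨Fin.tail f, h⟩⟩, Subtype.ext (Fin.cons_self_tail f)⟩
      · have hsurj (j : Fin (k + 1)) (hj : j ≠ f 0) : ∃ x, Fin.tail f x = j := by
          obtain ⟨x, rfl⟩ := hf j
          cases x using Fin.cases with
          | zero => exact absurd rfl hj
          | succ x => exact ⟨x, rfl⟩
        have hne (x : Fin n) : Fin.tail f x ≠ f 0 := fun hx => h fun j => by
          by_cases hj : j = f 0
          · exact ⟨x, hx.trans hj.symm⟩
          · exact hsurj j hj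
        choose g hg using fun x => Fin.exists_succAbove_eq (hne x)
        refine ⟨⟨f 0, .inr ⟨g, fun l => ?_⟩⟩, Subtype.ext ?_⟩
        · obtain ⟨x, hx⟩ := hsurj _ (Fin.succAbove_ne (f 0) l)
          exact ⟨x, Fin.succAbove_right_injective ((hg x).trans hx)⟩
        · have : (f 0).succAbove ∘ g = Fin.tail f := funext hg
          simp [F, this]
  rw [← Nat.card_eq_of_bijective F hF, Nat.card_prod, Nat.card_sum, Nat.card_fin]

theorem card_surjective_eq_stirlingSecond_mul (n k : ℕ) :
    Nat.card {f : Fin n → Fin k // Function.Surjective f} =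
      Nat.stirlingSecond n k * k.factorial := by
  induction n generalizing k with
  | zero =>
    cases k with
    | zero => simp [Function.Surjective]
    | succ k => simp [Function.Surjective]
  | succ n ih =>
    cases k with
    | zero => simp
    | succ k =>
      rw [card_surjective_succ, ih, ih, Nat.stirlingSecond_succ_succ, Nat.factorial_succ]
      ring

theorem stirling2_eq_stirlingSecond (n k : ℕ) : stirling2 n k = Nat.stirlingSecond n k :=
  Nat.eq_of_mul_eq_mul_right k.factorial_pos <| by
    rw [← card_surjective_eq_stirling2_mul, card_surjective_eq_stirlingSecond_mul]

theorem stirlingSecond_ne_zero {n k : ℕ} (hk : 1 ≤ k) (hn : k ≤ n) :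
    Nat.stirlingSecond n k ≠ 0 := by
  have : NeZero k := ⟨by omega⟩
  have : Nonempty {f : Fin n → Fin k // Function.Surjective f} :=
    ⟨fun i => Fin.ofNat k i, fun i => ⟨Fin.castLE hn i, by simp⟩⟩
  refine left_ne_zero_of_mul (b := k.factorial) ?_
  rw [← card_surjective_eq_stirlingSecond_mul]
  exact Nat.card_pos.ne'

/-- The degree (multiplicity) of the standard graded ring `R ⧸ √I_{n,k}` equals the
Stirling number of the second kind `S(n,k)`. -/
theorem vanIdeal_radical_degree (K : Type*) [Field K] (n k : ℕ) (hk : 1 ≤ k) (hn : k < n) :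
    hasDegree K (vanIdeal K n k).radical (stirling2 n k) := by
  rw [radical_vanIdeal, stirling2_eq_stirlingSecond]
  refine ⟨Polynomial.hilbertPoly (hilbertNumerator n k) k, k,
    ringKrullDim_quotient_diagIdeal hk hn.le, ?_, ?_⟩
  · filter_upwards [Filter.eventually_gt_atTop (hilbertNumerator n k).natDegree] with j hj
    rw [← Polynomial.coeff_mul_invOneSubPow_eq_hilbertPoly_eval k hj, ← mk_card_stdExponents,
      PowerSeries.coeff_mk, hilbertFn_diagIdeal]
  · obtain ⟨k, rfl⟩ := Nat.exists_eq_add_of_le' hk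
    have h := eval_one_hilbertNumerator n (k + 1)
    rw [leadingCoeff_hilbertPoly_succ, h, Nat.add_sub_cancel,
      mul_div_cancel₀ _ (Nat.cast_ne_zero.2 k.factorial_ne_zero)]
    rw [h]
    exact Nat.cast_ne_zero.2 (stirlingSecond_ne_zero hk hn.le)
end
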